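/- arXiv:0804.1437 — 4 statements merged into one kernel-verified Lean document; each statement's English description precedes it below -/
import Mathlib

section
/- Let S be a countably compact topological inverse semigroup. Then S contains no isomorphic copy of the bicyclic semigroup; that is, there is no injective map from the bicyclic semigroup 𝒞(p,q) into S that preserves multiplication. -/
/-- A topological space is countably compact if every countable open cover
has a finite subcover. -/
def CountablyCompact (X : Type*) [TopologicalSpace X] : Prop :=
  ∀ U : ℕ → Set X, (∀ n, IsOpen (U n)) → (⋃ n, U n) = Set.univ →
    ∃ t : Finset ℕ, (⋃ n ∈ t, U n) = Set.univ

/-- The multiplication of the bicyclic semigroup 𝒞(p,q), realized on ℕ × ℕ: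
(a,b)·(c,d) = (a + max b c − b, d + max b c − c). -/
def bicyclicMul (x y : ℕ × ℕ) : ℕ × ℕ :=
  (x.1 + max x.2 y.1 - x.2, y.2 + max x.2 y.1 - y.1)

/-- In a countably compact space every sequence has a cluster point. -/
theorem cc_cluster {X : Type*} [TopologicalSpace X] (h : CountablyCompact X) (u : ℕ → X) :
    ∃ x, MapClusterPt x Filter.atTop u := by
  by_contra hno
  push Not at hno
  obtain ⟨t, ht⟩ := h (fun n => (closure (u '' Set.Ici n))ᶜ)
    (fun n => isClosed_closure.isOpen_compl) (by
      rw [Set.eq_univ_iff_forall]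
      intro x
      have hx := hno x
      rw [mapClusterPt_iff_frequently] at hx
      push Not at hx
      obtain ⟨s, hs, hs'⟩ := hx
      rw [Filter.eventually_atTop] at hs'
      obtain ⟨n, hn⟩ := hs'
      refine Set.mem_iUnion.2 ⟨n, fun hc => ?_⟩
      obtain ⟨y, hy, m, hm, rfl⟩ := mem_closure_iff_nhds.1 hc s hs
      exact hn m hm hy)
  have hm : u (t.sup id) ∈ ⋃ n ∈ t, (closure (u '' Set.Ici n))ᶜ := by
    rw [ht]; trivial
  simp only [Set.mem_iUnion] at hm
  obtain ⟨n, hn, hc⟩ := hm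
  exact hc (subset_closure ⟨_, Finset.le_sup (f := id) hn, rfl⟩)

theorem inv_unique_aux {S : Type*} [Semigroup S]
    (hidem : ∀ e f : S, e * e = e → f * f = f → e * f = f * e) (a y z : S)
    (h1 : a * y * a = a) (h2 : y * a * y = y) (h3 : a * z * a = a) (h4 : z * a * z = z) :
    y = z := by
  have A : y * a = z * a := by
    have := hidem (y * a) (z * a) (by rw [← mul_assoc, h2]) (by rw [← mul_assoc, h4])
    rwa [mul_assoc, ← mul_assoc a, h3, mul_assoc z, ← mul_assoc a, h1] at this
  have B : a * y = a * z := by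
    have := hidem (a * y) (a * z) (by rw [← mul_assoc, h1]) (by rw [← mul_assoc, h3])
    rw [← mul_assoc, h1, ← mul_assoc, h3] at this
    exact this.symm
  rw [← h2, A, mul_assoc, B, ← mul_assoc, h4]

/-- A countably compact topological inverse semigroup contains no isomorphic copy
of the bicyclic semigroup. -/
theorem no_bicyclic_in_countably_compact_topological_inverse_semigroup
    {S : Type*} [Semigroup S] [TopologicalSpace S] [T2Space S]
    (inv : S → S)
    (hinv1 : ∀ a : S, a * inv a * a = a)
    (hinv2 : ∀ a : S, inv a * a * inv a = inv a)
    (hidem : ∀ e f : S, e * e = e → f * f = f → e * f = f * e)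
    (hmulc : Continuous fun p : S × S => p.1 * p.2)
    (hinvc : Continuous inv)
    (hcc : CountablyCompact S) :
    ¬ ∃ f : ℕ × ℕ → S, Function.Injective f ∧
        ∀ x y : ℕ × ℕ, f (bicyclicMul x y) = f x * f y := by
  rintro ⟨f, hf, hm⟩
  have hm' : ∀ a b c d : ℕ, f (a, b) * f (c, d) = f (a + max b c - b, d + max b c - c) :=
    fun a b c d => (hm (a, b) (c, d)).symm
  have hiv : ∀ n, inv (f (n, 0)) = f (0, n) := fun n =>
    inv_unique_aux hidem (f (n, 0)) _ _ (hinv1 _) (hinv2 _) (by simp [hm']) (by simp [hm'])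
  obtain ⟨x, hx⟩ := cc_cluster hcc (fun n => f (n, 0))
  obtain ⟨U, hU, hUx⟩ := mapClusterPt_iff_ultrafilter.1 hx
  have hT : ∀ {u v : ℕ → S} {a b : S}, Filter.Tendsto u U (nhds a) →
      Filter.Tendsto v U (nhds b) → Filter.Tendsto (fun n => u n * v n) U (nhds (a * b)) :=
    fun {u v a b} hu hv => (hmulc.tendsto (a, b)).comp (hu.prodMk_nhds hv)
  have hc : ∀ a : S, Filter.Tendsto (fun _ : ℕ => a) U (nhds a) := fun a => tendsto_const_nhds
  have hUi : Filter.Tendsto (fun n => f (0, n)) U (nhds (inv x)) := by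
    have := (hinvc.tendsto x).comp hUx
    refine this.congr fun n => hiv n
  obtain ⟨e, he⟩ : ∃ e, e = x * inv x := ⟨_, rfl⟩
  have hUe : Filter.Tendsto (fun n => f (n, n)) U (nhds e) := by
    rw [he]
    refine (hT hUx hUi).congr fun n => ?_
    simp [hm']
  have hix : inv x * x = f (0, 0) := by
    refine tendsto_nhds_unique (hT hUi hUx) ((hc (f (0, 0))).congr fun n => ?_)
    simp [hm']
  have hee : e * e = e := by rw [he, ← mul_assoc, hinv1]
  have hex : e * x = x := by rw [he, hinv1]
  -- `e` lies below every `f (n, n)`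
  have hle : ∀ n, e * f (n, n) = e := fun n => by
    refine tendsto_nhds_unique_of_eventuallyEq (hT hUe (hc (f (n, n)))) hUe ?_
    filter_upwards [hU (Filter.eventually_ge_atTop n)] with m hmn
    simp [hm', max_eq_left hmn]
  have hle' : ∀ n, f (n, n) * e = e := fun n => by
    rw [← hidem _ _ hee (by simp [hm']), hle]
  have hconj : ∀ n, f (n, 0) * e * f (0, n) = e := fun n => by
    have hL : Filter.Tendsto (fun m => f (n + m, n + m)) U (nhds (f (n, 0) * e * f (0, n))) := by
      refine (hT (hT (hc (f (n, 0))) hUe) (hc (f (0, n)))).congr fun m => ?_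
      simp [hm']
    generalize f (n, 0) * e * f (0, n) = e' at hL
    have i1 : e' * e' = e' :=
      tendsto_nhds_unique (hT hL hL) (hL.congr fun m => by simp [hm'])
    have i2 : e' * e = e :=
      tendsto_nhds_unique (hT hL (hc e)) ((hc e).congr fun m => (hle' _).symm)
    have i3 : e * e' = e' := by
      have hk : ∀ k, f (k, k) * e' = e' := fun k => by
        refine tendsto_nhds_unique_of_eventuallyEq (hT (hc (f (k, k))) hL) hL ?_
        filter_upwards [hU (Filter.eventually_ge_atTop k)] with m hmn
        simp [hm', max_eq_right (show k ≤ n + m by omega)]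
      exact tendsto_nhds_unique (hT hUe (hc e')) ((hc e').congr fun m => (hk m).symm)
    rw [← i3, hidem _ _ hee i1, i2]
  have hcomm : ∀ n, e * f (n, 0) = f (n, 0) * e := fun n => by
    have h0 : f (0, n) * f (n, 0) = f (0, 0) := by simp [hm']
    conv_lhs => rw [← hconj n]
    rw [mul_assoc, h0, mul_assoc, hle]
  have hxe : e * x = x * e :=
    tendsto_nhds_unique (hT (hc e) hUx) ((hT hUx (hc e)).congr fun n => (hcomm n).symm)
  have h0 : f (0, 0) = e := by
    rw [← hle' 0, ← hix, mul_assoc, ← hxe, hex]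
  have h1 : f (0, 0) = f (1, 1) := by
    have := hle 1
    rw [← h0] at this
    rw [← this]; simp [hm']
  simpa using hf h1
end

section
/- Every 0-simple countably compact topological inverse semigroup is completely 0-simple, i.e., it contains a primitive nonzero idempotent. -/
open Filter Topology in
theorem CountablyCompact.exists_cluster {X : Type*} [TopologicalSpace X]
    (h : CountablyCompact X) (u : ℕ → X) :
    ∃ x, ∃ F : Ultrafilter ℕ, (F : Filter ℕ) ≤ atTop ∧ Tendsto u F (𝓝 x) := by
  by_contra hcon
  have hno : ∀ x, ¬ MapClusterPt x atTop u := by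
    intro x hx
    obtain ⟨F, hF⟩ := mapClusterPt_iff_ultrafilter.1 hx
    exact hcon ⟨x, F, hF⟩
  obtain ⟨t, ht⟩ := h (fun n => (closure (Set.image u (Set.Ici n)))ᶜ)
    (fun n => isClosed_closure.isOpen_compl) (by
      rw [Set.eq_univ_iff_forall]
      intro x
      by_contra hx
      simp only [Set.mem_iUnion, Set.mem_compl_iff, not_exists, not_not] at hx
      apply hno x
      rw [mapClusterPt_iff_frequently]
      intro s hs
      rw [frequently_atTop]
      intro n
      obtain ⟨y, hy, k, hk, rfl⟩ := mem_closure_iff_nhds.1 (hx n) s hs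
      exact ⟨k, hk, hy⟩)
  have hm : u (t.sup id) ∈ ⋃ n ∈ t, (closure (Set.image u (Set.Ici n)))ᶜ := by
    rw [ht]; trivial
  simp only [Set.mem_iUnion] at hm
  obtain ⟨n, hn, hx⟩ := hm
  exact hx (subset_closure ⟨_, Finset.le_sup (f := id) hn, rfl⟩)

theorem inverse_unique_aux {S : Type*} [Semigroup S]
    (hidem : ∀ e f : S, e * e = e → f * f = f → e * f = f * e)
    (a b c : S) (h1 : a * b * a = a) (h2 : b * a * b = b)
    (h3 : a * c * a = a) (h4 : c * a * c = c) : b = c := by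
  have hba : (b * a) * (b * a) = b * a := by rw [← mul_assoc, h2]
  have hca : (c * a) * (c * a) = c * a := by rw [← mul_assoc, h4]
  have hab : (a * b) * (a * b) = a * b := by rw [← mul_assoc, h1]
  have hac : (a * c) * (a * c) = a * c := by rw [← mul_assoc, h3]
  calc b = b * (a * b) := by rw [← mul_assoc, h2]
    _ = b * ((a * c) * (a * b)) := by
        rw [← mul_assoc (a * c), h3]
    _ = b * ((a * b) * (a * c)) := by rw [hidem _ _ hab hac]
    _ = (b * a * b) * a * c := by simp only [mul_assoc]
    _ = b * a * c := by rw [h2]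
    _ = b * a * (c * a * c) := by rw [h4]
    _ = ((b * a) * (c * a)) * c := by simp only [mul_assoc]
    _ = ((c * a) * (b * a)) * c := by rw [hidem _ _ hba hca]
    _ = c * (a * b * a) * c := by simp only [mul_assoc]
    _ = c := by rw [h1, h4]

open Filter Topology in
/-- No copy of the bicyclic monoid in a countably compact topological inverse semigroup. -/
theorem no_bicyclic_aux
    {S : Type*} [Semigroup S] [TopologicalSpace S] [T2Space S]
    (inv : S → S)
    (hinv1 : ∀ a : S, a * inv a * a = a)
    (hinv2 : ∀ a : S, inv a * a * inv a = inv a)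
    (hidem : ∀ e f : S, e * e = e → f * f = f → e * f = f * e)
    (hmulc : Continuous fun p : S × S => p.1 * p.2)
    (hinvc : Continuous inv)
    (hcc : CountablyCompact S)
    (e p q : S) (hee : e * e = e) (hep : e * p = p) (hpe : p * e = p)
    (heq : e * q = q) (hqe : q * e = q) (hpq : p * q = e) : q * p = e := by
  have : ContinuousMul S := ⟨hmulc⟩
  let P : ℕ → S := fun n => Nat.rec e (fun _ x => x * p) n
  let Q : ℕ → S := fun n => Nat.rec e (fun _ x => q * x) n
  let E : ℕ → S := fun n => Nat.rec e (fun _ x => q * x * p) n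
  have P0 : P 0 = e := rfl
  have Q0 : Q 0 = e := rfl
  have E0 : E 0 = e := rfl
  have Ps : ∀ n, P (n+1) = P n * p := fun _ => rfl
  have Qs : ∀ n, Q (n+1) = q * Q n := fun _ => rfl
  have Es : ∀ n, E (n+1) = q * E n * p := fun _ => rfl
  have eP : ∀ n, e * P n = P n := by
    intro n
    induction n with
    | zero => exact hee
    | succ n ih => rw [Ps, ← mul_assoc, ih]
  have Pe : ∀ n, P n * e = P n := by
    intro n
    cases n with
    | zero => exact hee
    | succ n => rw [Ps, mul_assoc, hpe]
  have eQ : ∀ n, e * Q n = Q n := by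
    intro n
    cases n with
    | zero => exact hee
    | succ n => rw [Qs, ← mul_assoc, heq]
  have Qe : ∀ n, Q n * e = Q n := by
    intro n
    induction n with
    | zero => exact hee
    | succ n ih => rw [Qs, mul_assoc, ih]
  have eE : ∀ n, e * E n = E n := by
    intro n
    cases n with
    | zero => exact hee
    | succ n => rw [Es, ← mul_assoc, ← mul_assoc, heq]
  have Ee : ∀ n, E n * e = E n := by
    intro n
    cases n with
    | zero => exact hee
    | succ n => rw [Es, mul_assoc, hpe]
  have PQ : ∀ n, P n * Q n = e := by
    intro n
    induction n with
    | zero => exact hee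
    | succ n ih =>
      rw [Ps, Qs, mul_assoc, ← mul_assoc p, hpq, eQ, ih]
  have QP : ∀ n, Q n * P n = E n := by
    intro n
    induction n with
    | zero => exact hee
    | succ n ih =>
      rw [Ps, Qs, Es, ← ih]; simp only [mul_assoc]
  have hQ : ∀ n, inv (P n) = Q n := by
    intro n
    apply inverse_unique_aux hidem (P n) _ _ (hinv1 _) (hinv2 _)
    · rw [PQ, eP]
    · rw [mul_assoc, PQ, Qe]
  have hmulE : ∀ n m, q * E n * p * (q * E m * p) = q * (E n * E m) * p := by
    intro n m
    calc _ = q * E n * (p * q) * E m * p := by simp only [mul_assoc]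
      _ = _ := by rw [hpq, mul_assoc q, Ee]; simp only [mul_assoc]
  have EE : ∀ n m, n ≤ m → E n * E m = E m ∧ E m * E n = E m := by
    intro n
    induction n with
    | zero => intro m _; exact ⟨eE m, Ee m⟩
    | succ n ih =>
      intro m hm
      obtain ⟨k, rfl⟩ : ∃ k, m = k + 1 := ⟨m - 1, by omega⟩
      obtain ⟨h1, h2⟩ := ih k (by omega)
      rw [Es, Es, hmulE, hmulE, h1, h2]
      exact ⟨rfl, rfl⟩
  obtain ⟨x, F, hF, hx⟩ := hcc.exists_cluster P
  have hix : Tendsto (fun n => inv (P n)) F (𝓝 (inv x)) := (hinvc.tendsto x).comp hx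
  have hxe : x * inv x = e := by
    have h := hx.mul hix
    have h2 : (fun n => P n * inv (P n)) = fun _ => e := by
      funext n; rw [hQ, PQ]
    rw [h2] at h
    exact tendsto_nhds_unique h tendsto_const_nhds
  obtain ⟨c, hc⟩ : ∃ c, c = inv x * x := ⟨_, rfl⟩
  have hE : Tendsto E F (𝓝 c) := by
    have h := hix.mul hx
    have h2 : (fun n => inv (P n) * P n) = E := by
      funext n; rw [hQ, QP]
    rw [h2] at h
    rw [hc]; exact h
  have hE1 : Tendsto (fun n => E (n+1)) F (𝓝 (q * c * p)) := by
    simp only [Es]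
    exact (hE.const_mul q).mul_const p
  have hev : ∀ m, ∀ᶠ n in (F : Filter ℕ), m ≤ n := fun m => hF (eventually_ge_atTop m)
  have Ec : ∀ m, E m * c = c := by
    intro m
    refine tendsto_nhds_unique_of_eventuallyEq (hE.const_mul (E m)) hE ?_
    filter_upwards [hev m] with n hn
    exact (EE m n hn).1
  have dE : ∀ m, q * c * p * E m = q * c * p := by
    intro m
    refine tendsto_nhds_unique_of_eventuallyEq (hE1.mul_const (E m)) hE1 ?_
    filter_upwards [hev m] with n hn
    exact (EE m (n+1) (by omega)).2
  have hdc : q * c * p = c := by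
    have h1 : q * c * p * c = q * c * p := by
      refine tendsto_nhds_unique (hE.const_mul (q * c * p)) ?_
      simp only [dE]
      exact tendsto_const_nhds
    have h2 : q * c * p * c = c := by
      refine tendsto_nhds_unique (hE1.mul_const c) ?_
      simp only [Ec]
      exact tendsto_const_nhds
    rw [← h1, h2]
  have ec : e * c = c := Ec 0
  have ce : c * e = c := by
    refine tendsto_nhds_unique (hE.mul_const e) ?_
    simp only [Ee]
    exact hE
  have hpc : p * c = c * p := by
    calc p * c = p * (q * c * p) := by rw [hdc]
      _ = (p * q) * c * p := by simp only [mul_assoc]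
      _ = c * p := by rw [hpq, ec]
  have hPc : ∀ n, P n * c = c * P n := by
    intro n
    induction n with
    | zero => rw [P0, ec, ce]
    | succ n ih => rw [Ps, mul_assoc, hpc, ← mul_assoc, ih, mul_assoc]
  have hxc : x * c = c * x := by
    refine tendsto_nhds_unique (hx.mul_const c) ?_
    simp only [hPc]
    exact hx.const_mul c
  have hcx : c * x = x := by
    rw [← hxc, hc, ← mul_assoc, hinv1]
  have hce : c = e := by
    rw [← ce, ← hxe, ← mul_assoc, hcx]
  have h1 := Ec 1
  have h2 : E 1 = q * e * p := rfl
  rw [hce, Ee, h2, hqe] at h1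
  exact h1

/-- Every 0-simple countably compact topological inverse semigroup is completely
0-simple, i.e. it contains a primitive nonzero idempotent. -/
theorem zero_simple_countably_compact_is_completely_zero_simple
    {S : Type*} [Semigroup S] [TopologicalSpace S] [T2Space S]
    (inv : S → S)
    (hinv1 : ∀ a : S, a * inv a * a = a)
    (hinv2 : ∀ a : S, inv a * a * inv a = inv a)
    (hidem : ∀ e f : S, e * e = e → f * f = f → e * f = f * e)
    (hmulc : Continuous fun p : S × S => p.1 * p.2)
    (hinvc : Continuous inv)
    (hcc : CountablyCompact S)
    (z : S) (hz : ∀ x : S, z * x = z ∧ x * z = z)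
    (hSS : ∃ a b : S, a * b ≠ z)
    (hideal : ∀ I : Set S, I.Nonempty →
      (∀ i ∈ I, ∀ s : S, s * i ∈ I ∧ i * s ∈ I) → I = {z} ∨ I = Set.univ) :
    ∃ e : S, e * e = e ∧ e ≠ z ∧
      ∀ f : S, f * f = f → f ≠ z → f * e = f → e * f = f → f = e := by
  obtain ⟨a, b, hab⟩ := hSS
  have ha : a ≠ z := fun h => hab (by rw [h]; exact (hz b).1)
  have hee : (a * inv a) * (a * inv a) = a * inv a := by rw [← mul_assoc, hinv1]
  have hez : a * inv a ≠ z := by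
    intro h
    apply ha
    rw [← hinv1 a, h]
    exact (hz a).1
  generalize a * inv a = e at hee hez
  refine ⟨e, hee, hez, ?_⟩
  intro f hff hfz hfe hef
  have hI : {x : S | ∃ s t, x = s * f * t} = Set.univ := by
    rcases hideal {x : S | ∃ s t, x = s * f * t} ⟨f * f * f, f, f, rfl⟩ (by
      rintro _ ⟨s, t, rfl⟩ r
      exact ⟨⟨r * s, t, by simp only [mul_assoc]⟩, ⟨s, t * r, by simp only [mul_assoc]⟩⟩) with h | h
    · exfalso
      have : f ∈ {x : S | ∃ s t, x = s * f * t} := ⟨f, f, by rw [hff, hff]⟩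
      rw [h] at this
      exact hfz this
    · exact h
  have he : e ∈ {x : S | ∃ s t, x = s * f * t} := by rw [hI]; trivial
  obtain ⟨s, t, hst⟩ := he
  have key := no_bicyclic_aux inv hinv1 hinv2 hidem hmulc hinvc hcc e (e * s * f) (f * t * e) hee
    (by rw [← mul_assoc, ← mul_assoc, hee]) (by rw [mul_assoc, hfe])
    (by rw [← mul_assoc, ← mul_assoc, hef]) (by rw [mul_assoc, hee])
    (by
      calc e * s * f * (f * t * e) = e * (s * (f * f) * t) * e := by simp only [mul_assoc]
        _ = e := by rw [hff, ← hst, hee, hee])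
  calc f = f * e := hfe.symm
    _ = f * (f * t * e * (e * s * f)) := by rw [key]
    _ = (f * f) * t * e * (e * s * f) := by simp only [mul_assoc]
    _ = e := by rw [hff, key]
end

section
/- Let S be a monoid, I a nonempty index set, and suppose the Brandt I-extension B_I(S) carries a Hausdorff topology for which the multiplication of B_I(S) is continuous. Then for every subset A ⊆ S and all α, β, γ, δ ∈ I, the subspaces A_{αβ} and A_{γδ} of B_I(S) are homeomorphic. -/
open scoped Classical

/-- The multiplication of the Brandt `I`-extension `B_I(S) = (I × S × I) ∪ {0}`
of a semigroup `S`, realized on `Option (I × S × I)` with `none` playing the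
role of the zero. -/
noncomputable def brandtMul {I S : Type*} [Mul S] :
    Option (I × S × I) → Option (I × S × I) → Option (I × S × I)
  | some (α, a, β), some (γ, b, δ) => if β = γ then some (α, a * b, δ) else none
  | _, _ => none

/-- For `A ⊆ S`, the subset `A_{αβ} = {(α,a,β) : a ∈ A}` of `B_I(S)`. -/
def brandtBlock {I S : Type*} (A : Set S) (α β : I) : Set (Option (I × S × I)) :=
  {x | ∃ a ∈ A, x = some (α, a, β)}

/-- If the Brandt `I`-extension `B_I(S)` of a monoid `S` carries a Hausdorff topology
with continuous multiplication, then for every `A ⊆ S` and all `α, β, γ, δ ∈ I` the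
subspaces `A_{αβ}` and `A_{γδ}` are homeomorphic. -/
theorem brandtBlocks_homeomorphic
    {I S : Type*} [Monoid S] [Nonempty I]
    [TopologicalSpace (Option (I × S × I))] [T2Space (Option (I × S × I))]
    (hmulc : Continuous fun p : Option (I × S × I) × Option (I × S × I) =>
      brandtMul p.1 p.2) :
    ∀ (A : Set S) (α β γ δ : I),
      Nonempty (brandtBlock A α β ≃ₜ brandtBlock A γ δ) := by
  intro A α β γ δ
  have hT : ∀ α β γ δ : I, Continuous fun x : Option (I × S × I) =>
      brandtMul (brandtMul (some (γ, 1, α)) x) (some (β, 1, δ)) := by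
    intro α β γ δ
    have h1 : Continuous fun x : Option (I × S × I) => brandtMul (some (γ, 1, α)) x :=
      hmulc.comp (Continuous.prodMk continuous_const continuous_id)
    exact hmulc.comp (Continuous.prodMk h1 continuous_const)
  have hv : ∀ (α β γ δ : I) (a : S),
      brandtMul (brandtMul (some (γ, 1, α)) (some (α, a, β))) (some (β, 1, δ))
        = some (γ, a, δ) := by
    intro α β γ δ a
    simp [brandtMul]
  have hm : ∀ (α β γ δ : I) (x : Option (I × S × I)), x ∈ brandtBlock A α β →
      brandtMul (brandtMul (some (γ, 1, α)) x) (some (β, 1, δ)) ∈ brandtBlock A γ δ := by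
    rintro α β γ δ x ⟨a, ha, rfl⟩
    exact ⟨a, ha, hv α β γ δ a⟩
  refine ⟨{ toFun := fun x => ⟨_, hm α β γ δ x.1 x.2⟩
            invFun := fun x => ⟨_, hm γ δ α β x.1 x.2⟩
            left_inv := ?_
            right_inv := ?_
            continuous_toFun := ((hT α β γ δ).comp continuous_subtype_val).subtype_mk _
            continuous_invFun := ((hT γ δ α β).comp continuous_subtype_val).subtype_mk _ }⟩
  · rintro ⟨x, a, ha, rfl⟩
    apply Subtype.ext
    simp only [hv]
  · rintro ⟨x, a, ha, rfl⟩
    apply Subtype.ext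
    simp only [hv]
end

section
/- The underlying topological space of a 0-simple countably compact topological inverse semigroup is Tychonoff (completely regular and Hausdorff) and pseudocompact. -/
open Filter Topology

theorem cc_ultra {S : Type*} [TopologicalSpace S] (hcc : CountablyCompact S) (u : ℕ → S) :
    ∃ (c : S) (U : Ultrafilter ℕ), (U : Filter ℕ) ≤ atTop ∧ Tendsto u U (𝓝 c) := by
  suffices h : ∃ c, MapClusterPt c atTop u by
    obtain ⟨c, hc⟩ := h
    obtain ⟨U, h1, h2⟩ := mapClusterPt_iff_ultrafilter.1 hc
    exact ⟨c, U, h1, h2⟩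
  by_contra hno
  push Not at hno
  obtain ⟨t, ht⟩ := hcc (fun n => (closure (u '' Set.Ici n))ᶜ)
    (fun n => isClosed_closure.isOpen_compl) (by
      rw [Set.eq_univ_iff_forall]
      intro x
      by_contra hx
      simp only [Set.mem_iUnion, Set.mem_compl_iff, not_exists, not_not] at hx
      apply hno x
      rw [mapClusterPt_iff_frequently]
      intro s hs
      rw [frequently_atTop]
      intro n
      obtain ⟨y, hy, k, hk, rfl⟩ := mem_closure_iff_nhds.1 (hx n) s hs
      exact ⟨k, hk, hy⟩)
  have := Set.eq_univ_iff_forall.1 ht (u (t.sup id))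
  simp only [Set.mem_iUnion] at this
  obtain ⟨n, hn, h⟩ := this
  exact h (subset_closure ⟨t.sup id, Finset.le_sup (f := id) hn, rfl⟩)

section alg
variable {S : Type*} [Semigroup S] {inv : S → S}

theorem my_inv_unique (hidem : ∀ e f : S, e * e = e → f * f = f → e * f = f * e)
    {x y w : S} (h1 : x * y * x = x) (h2 : y * x * y = y)
    (h3 : x * w * x = x) (h4 : w * x * w = w) : y = w := by
  have i1 : (x * y) * (x * y) = x * y := by rw [← mul_assoc, h1]
  have i2 : (x * w) * (x * w) = x * w := by rw [← mul_assoc, h3]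
  have i3 : (y * x) * (y * x) = y * x := by rw [← mul_assoc, h2]
  have i4 : (w * x) * (w * x) = w * x := by rw [← mul_assoc, h4]
  have e1 : y = y * x * w := by
    calc y = y * x * y := h2.symm
      _ = y * (x * w * x) * y := by rw [h3]
      _ = y * ((x * w) * (x * y)) := by simp only [mul_assoc]
      _ = y * ((x * y) * (x * w)) := by rw [hidem _ _ i2 i1]
      _ = (y * x * y) * (x * w) := by simp only [mul_assoc]
      _ = y * x * w := by rw [h2, mul_assoc]
  have e2 : w = y * x * w := by
    calc w = w * x * w := h4.symm
      _ = w * (x * y * x) * w := by rw [h1]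
      _ = ((w * x) * (y * x)) * w := by simp only [mul_assoc]
      _ = ((y * x) * (w * x)) * w := by rw [hidem _ _ i4 i3]
      _ = y * x * (w * x * w) := by simp only [mul_assoc]
      _ = y * x * w := by rw [h4]
  rw [e1, ← e2]

theorem my_inv_inv (hinv1 : ∀ a : S, a * inv a * a = a)
    (hinv2 : ∀ a : S, inv a * a * inv a = inv a)
    (hidem : ∀ e f : S, e * e = e → f * f = f → e * f = f * e) (x : S) : inv (inv x) = x :=
  my_inv_unique hidem (hinv1 (inv x)) (hinv2 (inv x)) (hinv2 x) (hinv1 x)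

theorem idem_l (hinv1 : ∀ a : S, a * inv a * a = a) (x : S) :
    (x * inv x) * (x * inv x) = x * inv x := by rw [← mul_assoc, hinv1]

theorem idem_r (hinv2 : ∀ a : S, inv a * a * inv a = inv a) (x : S) :
    (inv x * x) * (inv x * x) = inv x * x := by rw [← mul_assoc, hinv2]

theorem my_mul_inv (hinv1 : ∀ a : S, a * inv a * a = a)
    (hinv2 : ∀ a : S, inv a * a * inv a = inv a)
    (hidem : ∀ e f : S, e * e = e → f * f = f → e * f = f * e) (x y : S) :
    inv (x * y) = inv y * inv x := by
  refine my_inv_unique hidem (hinv1 _) (hinv2 _) ?_ ?_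
  · calc x * y * (inv y * inv x) * (x * y) = x * ((y * inv y) * (inv x * x)) * y := by
          simp only [mul_assoc]
      _ = x * ((inv x * x) * (y * inv y)) * y := by
          rw [hidem _ _ (idem_l hinv1 y) (idem_r hinv2 x)]
      _ = (x * inv x * x) * (y * inv y * y) := by simp only [mul_assoc]
      _ = x * y := by rw [hinv1, hinv1]
  · calc inv y * inv x * (x * y) * (inv y * inv x)
        = inv y * ((inv x * x) * (y * inv y)) * inv x := by simp only [mul_assoc]
      _ = inv y * ((y * inv y) * (inv x * x)) * inv x := by
          rw [hidem _ _ (idem_l hinv1 y) (idem_r hinv2 x)]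
      _ = (inv y * y * inv y) * (inv x * x * inv x) := by simp only [mul_assoc]
      _ = inv y * inv x := by rw [hinv2, hinv2]

end alg

section top
variable {S : Type*} [Semigroup S] [TopologicalSpace S] [T2Space S] {inv : S → S}

theorem tmul (hmulc : Continuous fun p : S × S => p.1 * p.2) {ι : Type*} {l : Filter ι}
    {u v : ι → S} {x y : S} (hu : Tendsto u l (𝓝 x)) (hv : Tendsto v l (𝓝 y)) :
    Tendsto (fun i => u i * v i) l (𝓝 (x * y)) :=
  (hmulc.tendsto (x, y)).comp (hu.prodMk_nhds hv)

/-- No bicyclic subsemigroup. -/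
theorem no_bicyclic (hinv1 : ∀ a : S, a * inv a * a = a)
    (hinv2 : ∀ a : S, inv a * a * inv a = inv a)
    (hidem : ∀ e f : S, e * e = e → f * f = f → e * f = f * e)
    (hmulc : Continuous fun p : S × S => p.1 * p.2)
    (hinvc : Continuous inv)
    (hcc : CountablyCompact S) (a e : S) (ha : a * inv a = e) (hae : a * e = a) :
    inv a * a = e := by
  have hee : e * e = e := by rw [← ha]; exact idem_l hinv1 a
  have hea : e * a = a := by rw [← ha, hinv1]
  have heb : e * inv a = inv a := by
    have := my_mul_inv hinv1 hinv2 hidem a e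
    have h2 : inv e = e := my_inv_unique hidem (hinv1 e) (hinv2 e)
      (by rw [hee, hee]) (by rw [hee, hee])
    rw [hae, h2] at this
    exact this.symm
  have hinve : inv e = e := my_inv_unique hidem (hinv1 e) (hinv2 e)
      (by rw [hee, hee]) (by rw [hee, hee])
  let A : ℕ → S := fun n => Nat.rec e (fun _ x => x * a) n
  have A0 : A 0 = e := rfl
  have As : ∀ n, A (n+1) = A n * a := fun n => rfl
  have Bs : ∀ n, inv (A (n+1)) = inv a * inv (A n) := fun n => by
    rw [As, my_mul_inv hinv1 hinv2 hidem]
  have Ae : ∀ n, A n * e = A n := by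
    intro n
    cases n with
    | zero => exact hee
    | succ n => rw [As, mul_assoc, hae]
  have eB : ∀ n, e * inv (A n) = inv (A n) := by
    intro n
    rw [← hinve, ← my_mul_inv hinv1 hinv2 hidem, Ae]
  have AB : ∀ n, A n * inv (A n) = e := by
    intro n
    induction n with
    | zero => rw [A0, hinve, hee]
    | succ n ih =>
      rw [As, my_mul_inv hinv1 hinv2 hidem, mul_assoc, ← mul_assoc a, ha, eB, ih]
  let G : ℕ → S := fun n => inv (A n) * A n
  have Gi : ∀ n, G n * G n = G n := fun n => idem_r hinv2 _
  have Gs : ∀ n, G (n+1) = inv a * G n * a := fun n => by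
    simp only [G, As, my_mul_inv hinv1 hinv2 hidem, mul_assoc]
  have Gs' : ∀ n, a * G (n+1) * inv a = G n := fun n => by
    calc a * G (n+1) * inv a = (a * inv a) * inv (A n) * (A n * (a * inv a)) := by
          simp only [Gs, G, mul_assoc]
      _ = G n := by rw [ha, eB, Ae]
  have AG : ∀ m k, A (m + k) * G m = A (m + k) := by
    intro m k
    have : ∃ w, A (m + k) = w * A m ∨ A (m+k) = A m := by
      refine ⟨A k, Or.inl ?_⟩
      clear_value G
      induction m with
      | zero => rw [A0, Ae, Nat.zero_add]
      | succ m ih => rw [show m + 1 + k = (m + k) + 1 by omega, As, As, ih, mul_assoc]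
    obtain ⟨w, h | h⟩ := this
    · rw [h]
      simp only [G]
      rw [mul_assoc, ← mul_assoc (A m), hinv1]
    · rw [h]
      simp only [G]
      rw [← mul_assoc (A m), hinv1]
  have GG : ∀ m j, m ≤ j → G j * G m = G j := by
    intro m j hmj
    obtain ⟨k, rfl⟩ := Nat.exists_eq_add_of_le hmj
    change inv (A (m+k)) * A (m+k) * G m = _
    rw [mul_assoc, AG]
  obtain ⟨c, U, hU, hc⟩ := cc_ultra hcc A
  have hci : Tendsto (fun n => inv (A n)) U (𝓝 (inv c)) := (hinvc.tendsto c).comp hc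
  have hce : c * inv c = e :=
    tendsto_nhds_unique (tmul hmulc hc hci) (by simp only [AB]; exact tendsto_const_nhds)
  obtain ⟨h, hh⟩ : ∃ h, h = inv c * c := ⟨_, rfl⟩
  have hG : Tendsto G U (𝓝 h) := by rw [hh]; exact tmul hmulc hci hc
  have hhG : ∀ m, h * G m = h := fun m => by
    refine tendsto_nhds_unique (tmul hmulc hG (tendsto_const_nhds (x := G m))) (hG.congr' ?_)
    filter_upwards [hU (eventually_ge_atTop m)] with j hj
    exact (GG m j hj).symm
  have hG' : Tendsto (fun j => G (j - 1)) U (𝓝 (a * h * inv a)) := by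
    refine (tmul hmulc (tmul hmulc (tendsto_const_nhds (x := a)) hG)
      (tendsto_const_nhds (x := inv a))).congr' ?_
    filter_upwards [hU (eventually_ge_atTop 1)] with j hj
    obtain ⟨k, rfl⟩ := Nat.exists_eq_add_of_le' hj
    exact Gs' k
  obtain ⟨h', hh'⟩ : ∃ h', h' = a * h * inv a := ⟨_, rfl⟩
  rw [← hh'] at hG'
  have hhG' : ∀ m, h' * G m = h' := fun m => by
    refine tendsto_nhds_unique (tmul hmulc hG' (tendsto_const_nhds (x := G m))) (hG'.congr' ?_)
    filter_upwards [hU (eventually_ge_atTop (m+1))] with j hj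
    exact (GG m (j-1) (by omega)).symm
  have e1 : h' * h = h' := tendsto_nhds_unique (tmul hmulc (tendsto_const_nhds (x := h')) hG)
    (by simp only [hhG']; exact tendsto_const_nhds)
  have e2 : h * h' = h := tendsto_nhds_unique (tmul hmulc (tendsto_const_nhds (x := h)) hG')
    (by simp only [hhG]; exact tendsto_const_nhds)
  have ih : h * h = h := by rw [hh]; exact idem_r hinv2 c
  have ih' : h' * h' = h' :=
    tendsto_nhds_unique (tmul hmulc hG' hG') (by simp only [Gi]; exact hG')
  have hEq : h' = h := by rw [← e1, hidem _ _ ih' ih, e2]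
  have hah : a * h * inv a = h := by rw [← hh', hEq]
  have heh : e * h * e = h := by
    rw [← hah]
    calc e * (a * h * inv a) * e = (e * a) * h * (inv a * e) := by simp only [mul_assoc]
      _ = _ := by
        rw [hea]
        congr 1
        rw [← hinve, ← my_mul_inv hinv1 hinv2 hidem, hea]
  have hA : ∀ n, A n * h * inv (A n) = h := by
    intro n
    induction n with
    | zero => rw [A0, hinve, heh]
    | succ n ih2 =>
      rw [As, my_mul_inv hinv1 hinv2 hidem]
      calc A n * a * h * (inv a * inv (A n)) = A n * (a * h * inv a) * inv (A n) := by
            simp only [mul_assoc]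
        _ = h := by rw [hah, ih2]
  have hlim : c * h * inv c = h :=
    tendsto_nhds_unique (tmul hmulc (tmul hmulc hc (tendsto_const_nhds (x := h))) hci)
      (by simp only [hA]; exact tendsto_const_nhds)
  have hhe : h = e := by
    rw [← hlim, hh]
    calc c * (inv c * c) * inv c = (c * inv c) * (c * inv c) := by simp only [mul_assoc]
      _ = e := by rw [hce, hee]
  have h1 := hhG 1
  have hG1 : G 1 = inv a * a := by
    have : A 1 = a := by rw [show (1 : ℕ) = 0 + 1 from rfl, As, A0, hea]
    simp only [G, this]
  rw [hhe, hG1, ← mul_assoc, heb] at h1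
  exact h1

theorem group_cr (hinv1 : ∀ a : S, a * inv a * a = a)
    (hinv2 : ∀ a : S, inv a * a * inv a = inv a)
    (hidem : ∀ e f : S, e * e = e → f * f = f → e * f = f * e)
    (hmulc : Continuous fun p : S × S => p.1 * p.2)
    (hinvc : Continuous inv) (e : S) (hee : e * e = e) :
    CompletelyRegularSpace {x : S // x * inv x = e ∧ inv x * x = e} := by
  have hinve : inv e = e := my_inv_unique hidem (hinv1 e) (hinv2 e)
      (by rw [hee, hee]) (by rw [hee, hee])
  let T := {x : S // x * inv x = e ∧ inv x * x = e}
  have hl : ∀ x : T, e * x.1 = x.1 := fun x => by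
    have h := hinv1 x.1
    rwa [x.2.1] at h
  have hr : ∀ x : T, x.1 * e = x.1 := fun x => by
    have h := hinv1 x.1
    rwa [mul_assoc, x.2.2] at h
  let m : T → T → T := fun x y => ⟨x.1 * y.1, by
    rw [my_mul_inv hinv1 hinv2 hidem]
    constructor
    · calc x.1 * y.1 * (inv y.1 * inv x.1) = x.1 * (y.1 * inv y.1) * inv x.1 := by
            simp only [mul_assoc]
        _ = e := by rw [y.2.1, hr, x.2.1]
    · calc inv y.1 * inv x.1 * (x.1 * y.1) = inv y.1 * ((inv x.1 * x.1) * y.1) := by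
            simp only [mul_assoc]
        _ = e := by rw [x.2.2, hl, y.2.2]⟩
  let i : T → T := fun x => ⟨inv x.1, by
    rw [my_inv_inv hinv1 hinv2 hidem]; exact ⟨x.2.2, x.2.1⟩⟩
  letI : Mul T := ⟨m⟩
  letI : Inv T := ⟨i⟩
  letI : One T := ⟨⟨e, by rw [hinve]; exact ⟨hee, hee⟩⟩⟩
  letI : Group T := Group.ofLeftAxioms (fun x y w => Subtype.ext (mul_assoc x.1 y.1 w.1))
    (fun x => Subtype.ext (hl x)) (fun x => Subtype.ext x.2.2)
  haveI : IsTopologicalGroup T :=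
    { continuous_mul := Continuous.subtype_mk
        (hmulc.comp ((continuous_subtype_val.comp continuous_fst).prodMk
          (continuous_subtype_val.comp continuous_snd))) _
      continuous_inv := Continuous.subtype_mk (hinvc.comp continuous_subtype_val) _ }
  letI : UniformSpace T := IsTopologicalGroup.rightUniformSpace T
  exact (inferInstance : CompletelyRegularSpace T)

end top

theorem tychonoff_pseudocompact_of_zero_simple_countably_compact
    {S : Type*} [Semigroup S] [TopologicalSpace S] [T2Space S]
    (inv : S → S)
    (hinv1 : ∀ a : S, a * inv a * a = a)
    (hinv2 : ∀ a : S, inv a * a * inv a = inv a)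
    (hidem : ∀ e f : S, e * e = e → f * f = f → e * f = f * e)
    (hmulc : Continuous fun p : S × S => p.1 * p.2)
    (hinvc : Continuous inv)
    (hcc : CountablyCompact S)
    (z : S) (hz : ∀ x : S, z * x = z ∧ x * z = z)
    (hSS : ∃ a b : S, a * b ≠ z)
    (hideal : ∀ I : Set S, I.Nonempty →
      (∀ i ∈ I, ∀ s : S, s * i ∈ I ∧ i * s ∈ I) → I = {z} ∨ I = Set.univ) :
    CompletelyRegularSpace S ∧ T2Space S ∧
      ∀ f : S → ℝ, Continuous f → ∃ M : ℝ, ∀ x : S, |f x| ≤ M := by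
  -- linking elements
  have link : ∀ e f : S, e * e = e → f * f = f → f ≠ z →
      ∃ a, a * inv a = e ∧ inv a * a * f = inv a * a := by
    intro e f he hf hfz
    have hI : {w : S | ∃ x y, w = x * f * y} = Set.univ := by
      refine (hideal {w : S | ∃ x y, w = x * f * y} ⟨f, f, f, by rw [hf, hf]⟩ ?_).resolve_left ?_
      · rintro _ ⟨x, y, rfl⟩ s
        exact ⟨⟨s * x, y, by simp only [mul_assoc]⟩, ⟨x, y * s, by simp only [mul_assoc]⟩⟩
      · intro h
        have : f ∈ {w : S | ∃ x y, w = x * f * y} := ⟨f, f, by rw [hf, hf]⟩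
        rw [h] at this
        exact hfz this
    obtain ⟨x, y, hxy⟩ : e ∈ {w : S | ∃ x y, w = x * f * y} := by rw [hI]; trivial
    obtain ⟨a, ha⟩ : ∃ a, a = e * x * f := ⟨_, rfl⟩
    have h1 : a * y = e := by
      rw [ha, mul_assoc e, mul_assoc e, ← hxy, he]
    have h2 : e * a = a := by rw [ha, mul_assoc e, ← mul_assoc e, he]
    have h3 : a * f = a := by rw [ha, mul_assoc, hf]
    refine ⟨a, ?_, by rw [mul_assoc, h3]⟩
    have h4 : e * (a * inv a) = a * inv a := by rw [← mul_assoc, h2]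
    have h5 : (a * inv a) * e = e := by
      conv_lhs => rw [← h1, ← mul_assoc, hinv1, h1]
    rw [← h4, hidem _ _ he (idem_l hinv1 a), h5]
  have prim : ∀ e f : S, e * e = e → f * f = f → f ≠ z → f * e = f → f = e := by
    intro e f he hf hfz hfe
    obtain ⟨a, h1, h2⟩ := link e f he hf hfz
    have hae : a * e = a := by
      calc a * e = a * inv a * a * e := by rw [hinv1]
        _ = a * (inv a * a * f) * e := by rw [h2]; simp only [mul_assoc]
        _ = a * (inv a * a * (f * e)) := by simp only [mul_assoc]
        _ = a := by rw [hfe, h2, ← mul_assoc, hinv1]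
    have h3 := no_bicyclic hinv1 hinv2 hidem hmulc hinvc hcc a e h1 hae
    rw [h3, hidem _ _ he hf, hfe] at h2
    exact h2
  have orth : ∀ e f : S, e * e = e → f * f = f → e ≠ f → e * f = z := by
    intro e f he hf hne
    by_contra h
    have hi : (e * f) * (e * f) = e * f := by
      calc (e * f) * (e * f) = e * (f * e) * f := by simp only [mul_assoc]
        _ = e * (e * f) * f := by rw [hidem _ _ he hf]
        _ = (e * e) * (f * f) := by simp only [mul_assoc]
        _ = e * f := by rw [he, hf]
    have h1 := prim f (e * f) hf hi h (by rw [mul_assoc, hf])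
    have h2 := prim e (e * f) he hi h (by rw [hidem _ _ he hf, mul_assoc, he])
    exact hne (h2.symm.trans h1)
  have hfin : {e : S | e * e = e}.Finite := by
    by_contra hinf
    have hinf' : ({e : S | e * e = e} \ {z}).Infinite :=
      Set.Infinite.sdiff hinf (Set.finite_singleton z)
    let E := hinf'.natEmbedding
    have hE : ∀ n, (E n).1 * (E n).1 = (E n).1 := fun n => (E n).2.1
    have hEz : ∀ n, (E n).1 ≠ z := fun n => (E n).2.2
    have hEE : ∀ n m, n ≠ m → (E n).1 * (E m).1 = z := fun n m hnm =>
      orth _ _ (hE n) (hE m) (fun h => hnm (E.injective (Subtype.ext h)))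
    obtain ⟨e, he⟩ : ∃ e, e = (E 0).1 := ⟨_, rfl⟩
    have hee : e * e = e := by rw [he]; exact hE 0
    have hez : e ≠ z := by rw [he]; exact hEz 0
    choose a ha1 ha2 using fun n => link e (E n).1 hee (hE n) (hEz n)
    have ha3 : ∀ n, inv (a n) * a n = (E n).1 := fun n => by
      refine prim _ _ (hE n) (idem_r hinv2 _) ?_ (ha2 n)
      intro h
      apply hez
      rw [← ha1 n, ← hinv1 (a n), mul_assoc (a n), h, (hz _).2, (hz _).1]
    obtain ⟨c, U, hU, hc⟩ := cc_ultra hcc a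
    have hci : Tendsto (fun n => inv (a n)) U (𝓝 (inv c)) := (hinvc.tendsto c).comp hc
    have hce : c * inv c = e :=
      tendsto_nhds_unique (tmul hmulc hc hci) (by simp only [ha1]; exact tendsto_const_nhds)
    have hlim : Tendsto (fun n => (E n).1) U (𝓝 (inv c * c)) := by
      have := tmul hmulc hci hc
      simpa only [ha3] using this
    have h1 : ∀ m, (inv c * c) * (E m).1 = z := fun m => by
      refine tendsto_nhds_unique (tmul hmulc hlim (tendsto_const_nhds (x := (E m).1)))
        (tendsto_const_nhds.congr' ?_)
      filter_upwards [hU (eventually_gt_atTop m)] with j hj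
      exact (hEE j m (by omega)).symm
    have h2 : (inv c * c) * (inv c * c) = z :=
      tendsto_nhds_unique (tmul hmulc (tendsto_const_nhds (x := inv c * c)) hlim)
        (by simp only [h1]; exact tendsto_const_nhds)
    rw [idem_r hinv2] at h2
    apply hez
    rw [← hce, ← hinv1 c, mul_assoc c, h2, (hz _).2, (hz _).1]
  have clop : ∀ φ : S → S, Continuous φ → (∀ x, φ x * φ x = φ x) → ∀ e, IsClopen (φ ⁻¹' {e}) := by
    intro φ hφ hi e
    refine ⟨isClosed_singleton.preimage hφ, ?_⟩
    have : φ ⁻¹' {e} = (φ ⁻¹' ({f : S | f * f = f} \ {e}))ᶜ := by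
      ext x
      simp [hi]
    rw [this]
    exact ((hfin.subset Set.sdiff_subset).isClosed.preimage hφ).isOpen_compl
  have cl : Continuous fun x => x * inv x := hmulc.comp (continuous_id.prodMk hinvc)
  have cr : Continuous fun x => inv x * x := hmulc.comp (hinvc.prodMk continuous_id)
  refine ⟨⟨?_⟩, inferInstance, ?_⟩
  · intro x K hK hxK
    let D : Set S := (fun y => y * inv y) ⁻¹' {x * inv x} ∩ (fun y => inv y * y) ⁻¹' {inv x * x}
    have hD : IsClopen D := (clop _ cl (idem_l hinv1) _).inter (clop _ cr (idem_r hinv2) _)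
    have hG := group_cr hinv1 hinv2 hidem hmulc hinvc (x * inv x) (idem_l hinv1 x)
    let T := {y : S // y * inv y = x * inv x ∧ inv y * y = x * inv x}
    have hmem : ∀ y ∈ D, (y * inv x) * inv (y * inv x) = x * inv x ∧
        inv (y * inv x) * (y * inv x) = x * inv x := by
      rintro y ⟨h1, h2⟩
      simp only [Set.mem_preimage, Set.mem_singleton_iff] at h1 h2
      rw [my_mul_inv hinv1 hinv2 hidem, my_inv_inv hinv1 hinv2 hidem]
      constructor
      · calc y * inv x * (x * inv y) = y * (inv x * x) * inv y := by simp only [mul_assoc]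
          _ = _ := by rw [← h2, ← mul_assoc, hinv1, h1]
      · calc x * inv y * (y * inv x) = x * (inv y * y) * inv x := by simp only [mul_assoc]
          _ = _ := by rw [h2, ← mul_assoc, hinv1]
    have hxD : x ∈ D := ⟨rfl, rfl⟩
    let p : D → T := fun y => ⟨y.1 * inv x, hmem y.1 y.2⟩
    have hp : Continuous p := Continuous.subtype_mk
      (hmulc.comp (continuous_subtype_val.prodMk continuous_const)) _
    have hq : Continuous fun t : T => t.1 * x :=
      hmulc.comp (continuous_subtype_val.prodMk continuous_const)
    have hpq : ∀ y : D, (p y).1 * x = y.1 := fun y => by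
      have h2 : inv y.1 * y.1 = inv x * x := y.2.2
      change y.1 * inv x * x = y.1
      rw [mul_assoc, ← h2, ← mul_assoc, hinv1]
    obtain ⟨g, hgc, hg0, hg1⟩ := hG.completely_regular (p ⟨x, hxD⟩)
      ((fun t : T => t.1 * x) ⁻¹' K) (hK.preimage hq) (by
        change ¬ ((p ⟨x, hxD⟩).1 * x ∈ K)
        rw [hpq]; exact hxK)
    classical
    refine ⟨fun y => if h : y ∈ D then g (p ⟨y, h⟩) else 1, ?_, ?_, ?_⟩
    · rw [continuous_iff_continuousAt]
      intro y
      by_cases hy : y ∈ D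
      · have hcon : ContinuousOn (fun y => if h : y ∈ D then g (p ⟨y, h⟩) else 1) D := by
          rw [continuousOn_iff_continuous_domRestrict]
          refine (hgc.comp hp).congr ?_
          intro w
          simp [w.2]
        exact hcon.continuousAt (hD.isOpen.mem_nhds hy)
      · refine (continuousAt_const (y := (1 : unitInterval))).congr ?_
        filter_upwards [hD.compl.isOpen.mem_nhds hy] with w hw
        have hw' : w ∉ D := hw
        simp only [hw', dif_neg, not_false_eq_true]
    · simp only [hxD, dif_pos, hg0]
    · intro y hy
      by_cases h : y ∈ D
      · simp only [h, dif_pos]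
        apply hg1
        change (p ⟨y, h⟩).1 * x ∈ K
        rw [hpq]; exact hy
      · simp only [h, dif_neg, not_false_eq_true, Pi.one_apply]
  · intro f hf
    obtain ⟨t, ht⟩ := hcc (fun n => {x | |f x| < n})
      (fun n => isOpen_lt hf.abs continuous_const) (by
        rw [Set.eq_univ_iff_forall]
        intro x
        obtain ⟨n, hn⟩ := exists_nat_gt |f x|
        exact Set.mem_iUnion.2 ⟨n, hn⟩)
    refine ⟨(t.sup id : ℕ), fun x => ?_⟩
    have := Set.eq_univ_iff_forall.1 ht x
    simp only [Set.mem_iUnion] at this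
    obtain ⟨n, hn, h⟩ := this
    have h' : |f x| < n := h
    have h3 : n ≤ t.sup id := Finset.le_sup (f := id) hn
    exact h'.le.trans (by exact_mod_cast h3)
end
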